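/- Let k be a positive integer. Every maximal k-degenerate finite simple graph with more than k vertices is k-connected. -/

import Mathlib

open Finset

/-- `G` is `κ`-connected: it has more than `κ` vertices and deleting any set of
fewer than `κ` vertices leaves a connected graph. -/
def KConnected {V : Type*} [Fintype V] (G : SimpleGraph V) (κ : ℕ) : Prop :=
  κ < Fintype.card V ∧
    ∀ S : Finset V, S.card < κ → (G.induce ((↑S : Set V)ᶜ)).Connected

/-- `G` is `k`-degenerate: every nonempty induced subgraph has a vertex of
degree at most `k` (the degree of `v` in the subgraph induced on `s` is the number
of neighbours of `v` lying in `s`). -/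
def KDegenerate {V : Type*} (G : SimpleGraph V) (k : ℕ) : Prop :=
  ∀ s : Set V, s.Nonempty → ∃ v ∈ s, (s ∩ G.neighborSet v).ncard ≤ k

/-- `G` is maximal `k`-degenerate: it is `k`-degenerate and adding any edge between
nonadjacent vertices destroys `k`-degeneracy. -/
def MaxKDegenerate {V : Type*} (G : SimpleGraph V) (k : ℕ) : Prop :=
  KDegenerate G k ∧
    ∀ u v : V, u ≠ v → ¬ G.Adj u v → ¬ KDegenerate (G ⊔ SimpleGraph.edge u v) k

/-- Adding an edge `uv` at a vertex `v` of degree less than `k` inside `s` preserves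
`k`-degeneracy of the subgraph induced on `s`. -/
theorem KDegenerate.exists_ncard_le_sup_edge {V : Type*} [Finite V] {G : SimpleGraph V} {k : ℕ}
    (hG : KDegenerate G k) {s : Set V} {v : V} (hv : (s ∩ G.neighborSet v).ncard < k) (u : V)
    {t : Set V} (hts : t ⊆ s) (ht : t.Nonempty) :
    ∃ w ∈ t, (t ∩ (G ⊔ SimpleGraph.edge u v).neighborSet w).ncard ≤ k := by
  by_cases hvt : v ∈ t
  · refine ⟨v, hvt, ?_⟩
    have hsub : t ∩ (G ⊔ SimpleGraph.edge u v).neighborSet v ⊆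
        insert u (s ∩ G.neighborSet v) := by
      rintro x ⟨hx, hadj⟩
      have := hts hx
      simp only [SimpleGraph.mem_neighborSet, SimpleGraph.sup_adj, SimpleGraph.edge_adj] at hadj
      simp only [Set.mem_insert_iff, Set.mem_inter_iff, SimpleGraph.mem_neighborSet]
      grind
    have := Set.ncard_le_ncard hsub (Set.toFinite _)
    have := Set.ncard_insert_le u (s ∩ G.neighborSet v)
    omega
  · obtain ⟨w, hw, hle⟩ := hG t ht
    refine ⟨w, hw, le_trans (Set.ncard_le_ncard ?_ (Set.toFinite _)) hle⟩
    rintro x ⟨hx, hadj⟩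
    simp only [SimpleGraph.mem_neighborSet, SimpleGraph.sup_adj, SimpleGraph.edge_adj] at hadj
    simp only [Set.mem_inter_iff, SimpleGraph.mem_neighborSet]
    grind

/-- If fewer than `k` vertices separate `A` from `B` in a `k`-degenerate graph, then some edge
between `A` and `B` can be added without destroying `k`-degeneracy. -/
theorem KDegenerate.exists_sup_edge_of_separation {V : Type*} [Finite V] {G : SimpleGraph V}
    {k : ℕ} (hG : KDegenerate G k) {A B : Set V} (hAB : ∀ a ∈ A, ∀ b ∈ B, ¬ G.Adj a b)
    (hcard : (A ∪ B)ᶜ.ncard < k) (s : Set V) (hA : (s ∩ A).Nonempty) (hB : (s ∩ B).Nonempty) :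
    ∃ a ∈ A, ∃ b ∈ B, a ∈ s ∧ b ∈ s ∧ ∀ t ⊆ s, t.Nonempty →
      ∃ w ∈ t, (t ∩ (G ⊔ SimpleGraph.edge a b).neighborSet w).ncard ≤ k := by
  induction s using WellFoundedLT.induction with
  | ind s ih =>
    obtain ⟨v, hvs, hv⟩ := hG s (hA.mono Set.inter_subset_left)
    obtain ⟨a, has, haA⟩ := hA
    obtain ⟨b, hbs, hbB⟩ := hB
    by_cases hA' : ((s \ {v}) ∩ A).Nonempty
    · by_cases hB' : ((s \ {v}) ∩ B).Nonempty
      · obtain ⟨a, haA, b, hbB, ha, hb, h⟩ :=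
          ih (s \ {v}) (Set.sdiff_singleton_ssubset.2 hvs) hA' hB'
        refine ⟨a, haA, b, hbB, ha.1, hb.1, fun t hts ht => ?_⟩
        by_cases hvt : v ∈ t
        · refine ⟨v, hvt, le_trans (Set.ncard_le_ncard ?_ (Set.toFinite _)) hv⟩
          rintro x ⟨hx, hadj⟩
          have := hts hx
          simp only [Set.mem_sdiff, Set.mem_singleton_iff] at ha hb
          simp only [SimpleGraph.mem_neighborSet, SimpleGraph.sup_adj,
            SimpleGraph.edge_adj] at hadj
          simp only [Set.mem_inter_iff, SimpleGraph.mem_neighborSet]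
          grind
        · exact h t (Set.subset_sdiff_singleton hts hvt) ht
      · have huniq : ∀ x ∈ s, x ∈ B → x = v := fun x hx hxB => by
          by_contra hne
          exact hB' ⟨x, ⟨hx, hne⟩, hxB⟩
        obtain rfl := huniq b hbs hbB
        refine ⟨a, haA, b, hbB, has, hbs, fun t => hG.exists_ncard_le_sup_edge
          (lt_of_le_of_lt (Set.ncard_le_ncard ?_ (Set.toFinite _)) hcard) a⟩
        rintro x ⟨hx, hadj⟩ (hxA | hxB)
        · exact hAB x hxA b hbB hadj.symm
        · exact hadj.ne (huniq x hx hxB).symm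
    · have huniq : ∀ x ∈ s, x ∈ A → x = v := fun x hx hxA => by
        by_contra hne
        exact hA' ⟨x, ⟨hx, hne⟩, hxA⟩
      obtain rfl := huniq a has haA
      refine ⟨a, haA, b, hbB, has, hbs, fun t => ?_⟩
      rw [SimpleGraph.edge_comm]
      refine hG.exists_ncard_le_sup_edge
        (lt_of_le_of_lt (Set.ncard_le_ncard ?_ (Set.toFinite _)) hcard) b
      rintro x ⟨hx, hadj⟩ (hxA | hxB)
      · exact hadj.ne (huniq x hx hxA).symm
      · exact hAB a haA x hxB hadj

/-- Every maximal `k`-degenerate graph with more than `k` vertices is `k`-connected. -/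
theorem maxKDegenerate_kConnected {V : Type*} [Fintype V]
    (k : ℕ) (hk : 0 < k) (G : SimpleGraph V)
    (hG : MaxKDegenerate G k) (hcard : k < Fintype.card V) :
    KConnected G k := by
  refine ⟨hcard, fun S hS => ?_⟩
  have hne : Nonempty ↥((↑S : Set V)ᶜ) := by
    obtain ⟨x, hx⟩ := Finset.exists_mem_notMem_of_card_lt_card
      (s := S) (t := Finset.univ) (by rw [Finset.card_univ]; omega)
    exact ⟨x, by simpa using hx.2⟩
  refine ⟨fun x y => ?_⟩
  by_contra hxy
  set H := G.induce ((↑S : Set V)ᶜ)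
  let A : Set V := Subtype.val '' {z | H.Reachable x z}
  let B : Set V := Subtype.val '' {z | ¬ H.Reachable x z}
  have hAB : ∀ a ∈ A, ∀ b ∈ B, ¬ G.Adj a b := by
    rintro _ ⟨a, ha, rfl⟩ _ ⟨b, hb, rfl⟩ hadj
    exact hb (SimpleGraph.Reachable.trans ha (SimpleGraph.Adj.reachable (G := H) hadj))
  have hsub : (A ∪ B)ᶜ ⊆ (S : Set V) := by
    intro z hz
    by_contra hzS
    by_cases h : H.Reachable x ⟨z, hzS⟩
    · exact hz (Or.inl ⟨⟨z, hzS⟩, h, rfl⟩)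
    · exact hz (Or.inr ⟨⟨z, hzS⟩, h, rfl⟩)
  have hlt : (A ∪ B)ᶜ.ncard < k := by
    have := Set.ncard_le_ncard hsub (Set.toFinite _)
    rw [Set.ncard_coe_finset] at this
    omega
  obtain ⟨a, ha, b, hb, -, -, h⟩ := hG.1.exists_sup_edge_of_separation hAB hlt Set.univ
    ⟨x, trivial, x, SimpleGraph.Reachable.refl x, rfl⟩ ⟨y, trivial, y, hxy, rfl⟩
  refine hG.2 a b ?_ (hAB a ha b hb) fun t ht => h t (Set.subset_univ t) ht
  rintro rfl
  obtain ⟨p, hp, hpa⟩ := ha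
  obtain ⟨q, hq, hqa⟩ := hb
  obtain rfl := Subtype.ext (hpa.trans hqa.symm)
  exact hq hp
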